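/- Let q = 2^m, 1 < t < q, and N = (q+1)(t−1). There is no extended cyclic code over 𝔽_q with parameters [N+1, 3, N+1−t] whose dual code has minimum distance exactly 2. -/

import Mathlib

/-- A linear code `C ⊆ F^n` is cyclic if the cyclic shift
`(c₀, …, c_{n−1}) ↦ (c_{n−1}, c₀, …, c_{n−2})` maps `C` into itself. -/
def IsCyclicCode {F : Type*} [Field F] {n : ℕ} (C : Submodule F (Fin n → F)) : Prop :=
  ∀ c ∈ C, (fun i : Fin n => c ⟨((i : ℕ) + n - 1) % n, Nat.mod_lt _ i.pos⟩) ∈ C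

/-- The linear map sending a word to the word extended by the sum of its coordinates. -/
def extendLM (F : Type*) [Field F] (n : ℕ) : (Fin n → F) →ₗ[F] (Fin (n + 1) → F) where
  toFun c := Fin.snoc c (∑ i, c i)
  map_add' c d := by
    funext i
    refine Fin.lastCases ?_ (fun j => ?_) i
    · simp [Finset.sum_add_distrib]
    · simp
  map_smul' a c := by
    funext i
    refine Fin.lastCases ?_ (fun j => ?_) i
    · simp [Finset.mul_sum]
    · simp

/-- The extended code of a code of length `n`. -/
def extendCode {F : Type*} [Field F] {n : ℕ} (C : Submodule F (Fin n → F)) :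
    Submodule F (Fin (n + 1) → F) :=
  C.map (extendLM F n)

/-- The dual code `C⊥ = {x : Σ_i x_i c_i = 0 for all c ∈ C}`. -/
def dualCode {F : Type*} [Field F] {n : ℕ} (C : Submodule F (Fin n → F)) :
    Submodule F (Fin n → F) where
  carrier := {x | ∀ c ∈ C, ∑ i, x i * c i = 0}
  add_mem' := by
    intro a b ha hb c hc
    simpa [add_mul, Finset.sum_add_distrib] using by rw [ha c hc, hb c hc, add_zero]
  zero_mem' := by intro c hc; simp
  smul_mem' := by
    intro a x hx c hc
    simp only [Pi.smul_apply, smul_eq_mul, mul_assoc, ← Finset.mul_sum, hx c hc, mul_zero]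


/-- The kernel of a linear functional on a finite space contains at least a `1 / |F|` fraction of
its vectors. -/
theorem card_le_card_mul_card_ker {F V : Type*} [Field F] [Fintype F] [AddCommGroup V]
    [Module F V] [FiniteDimensional F V] (f : V →ₗ[F] F) :
    Nat.card V ≤ Fintype.card F * Nat.card (LinearMap.ker f) := by
  have h := f.finrank_range_add_finrank_ker
  have h_range : Module.finrank F (LinearMap.range f) ≤ 1 := by
    simpa using Submodule.finrank_le (LinearMap.range f)
  rw [Module.natCard_eq_pow_finrank (K := F) (V := V),
    Module.natCard_eq_pow_finrank (K := F) (V := LinearMap.ker f), Nat.card_eq_fintype_card,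
    mul_comm, ← pow_succ]
  exact Nat.pow_le_pow_right Fintype.card_pos (by lia)

/-- A linear functional is nonzero on at most a `(|F| - 1) / |F|` fraction of the vectors. -/
theorem card_mul_card_filter_ne_zero_le {F V : Type*} [Field F] [Fintype F] [DecidableEq F]
    [AddCommGroup V] [Module F V] [Fintype V] (f : V →ₗ[F] F) :
    Fintype.card F * (Finset.univ.filter fun v => f v ≠ 0).card + Fintype.card V ≤
      Fintype.card F * Fintype.card V := by
  have : FiniteDimensional F V := Module.Finite.of_finite
  have h := card_le_card_mul_card_ker f
  have h_ker : Nat.card (LinearMap.ker f) = (Finset.univ.filter fun v => f v = 0).card := by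
    rw [← Fintype.card_subtype, ← Nat.card_eq_fintype_card]
    rfl
  have h_split := Finset.card_filter_add_card_filter_not (s := (Finset.univ : Finset V))
    (fun v => f v = 0)
  rw [Finset.card_univ] at h_split
  rw [h_ker, Nat.card_eq_fintype_card] at h
  calc _ ≤ _ := Nat.add_le_add_left h _
    _ = _ := by rw [← Nat.mul_add, add_comm, h_split]

/-- Plotkin-type bound: if all nonzero words of a code have weight at least `d` and `S` contains
every coordinate at which the code does not vanish, then the average weight bounds `d`. -/
theorem plotkin_bound {F ι : Type*} [Field F] [Fintype F] [DecidableEq F] [Fintype ι]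
    (K : Submodule F (ι → F)) (d : ℕ) (hd : ∀ c ∈ K, c ≠ 0 → d ≤ hammingNorm c)
    (S : Finset ι) (hS : ∀ c ∈ K, ∀ l ∉ S, c l = 0) :
    Fintype.card F * ((Nat.card K - 1) * d) + S.card * Nat.card K ≤
      S.card * (Fintype.card F * Nat.card K) := by
  classical
  have : Fintype K := Fintype.ofFinite K
  rw [Nat.card_eq_fintype_card]
  have h_weight (c : K) : hammingNorm (c : ι → F) = ∑ l ∈ S, if (c : ι → F) l ≠ 0 then 1 else 0 := by
    rw [← Finset.card_filter, hammingNorm]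
    congr 1
    ext l
    simp only [Finset.mem_filter, Finset.mem_univ, true_and]
    exact ⟨fun h => ⟨by_contra fun hl => h (hS c c.2 l hl), h⟩, fun h => h.2⟩
  have h_lower : (Fintype.card K - 1) * d ≤ ∑ c : K, hammingNorm (c : ι → F) := by
    rw [← Finset.card_univ, ← Finset.card_erase_of_mem (Finset.mem_univ (0 : K)), ← smul_eq_mul]
    refine (Finset.card_nsmul_le_sum _ _ d fun (c : K) hc => hd c c.2 ?_).trans
      (Finset.sum_le_sum_of_subset (Finset.erase_subset _ _))
    simpa using hc
  have h_upper : ∑ c : K, hammingNorm (c : ι → F) =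
      ∑ l ∈ S, (Finset.univ.filter fun c : K => (c : ι → F) l ≠ 0).card := by
    simp only [h_weight, Finset.card_filter]
    exact Finset.sum_comm
  calc _ ≤ Fintype.card F * (∑ l ∈ S, (Finset.univ.filter fun c : K => (c : ι → F) l ≠ 0).card)
        + S.card * Fintype.card K := by rw [← h_upper]; gcongr
    _ = ∑ l ∈ S, (Fintype.card F * (Finset.univ.filter fun c : K => (c : ι → F) l ≠ 0).card
        + Fintype.card K) := by
      rw [Finset.sum_add_distrib, Finset.mul_sum, Finset.sum_const, smul_eq_mul]
    _ ≤ ∑ l ∈ S, Fintype.card F * Fintype.card K :=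
      Finset.sum_le_sum fun l _ =>
        card_mul_card_filter_ne_zero_le ((LinearMap.proj l).comp K.subtype)
    _ = _ := by rw [Finset.sum_const, smul_eq_mul]

/-- Imposing one linear condition drops the dimension of a subspace by at most one. -/
theorem finrank_le_finrank_inf_ker_add_one {F V : Type*} [Field F] [AddCommGroup V] [Module F V]
    [FiniteDimensional F V] (C : Submodule F V) (f : V →ₗ[F] F) :
    Module.finrank F C ≤ Module.finrank F (C ⊓ LinearMap.ker f : Submodule F V) + 1 := by
  have h := Submodule.finrank_sup_add_finrank_inf_eq C (LinearMap.ker f)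
  have h_sup := Submodule.finrank_le (C ⊔ LinearMap.ker f)
  have h_rank := f.finrank_range_add_finrank_ker
  have h_range : Module.finrank F (LinearMap.range f) ≤ 1 := by
    simpa using Submodule.finrank_le (LinearMap.range f)
  lia

/-- **Lemma (no extended cyclic `[N+1, 3, N+1−t]` code has dual distance `2`).**
Let `q = 2^m`, `1 < t < q`, and `N = (q+1)(t−1)`.  There is no extended cyclic code over
`𝔽_q` with parameters `[N+1, 3, N+1−t]` whose dual code has minimum distance exactly `2`. -/
theorem no_extended_cyclic_code_with_dual_dist_two
    (m q t N : ℕ) (hm : 1 ≤ m) (hq : q = 2 ^ m) (ht1 : 1 < t) (ht2 : t < q)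
    (hN : N = (q + 1) * (t - 1))
    (F : Type*) [Field F] [Fintype F] [DecidableEq F] (hF : Fintype.card F = q) :
    ¬ ∃ C : Submodule F (Fin (N + 1) → F),
      (∃ C' : Submodule F (Fin N → F), IsCyclicCode C' ∧ C = extendCode C') ∧
      Module.finrank F ↥C = 3 ∧
      (∀ c ∈ C, c ≠ 0 → N + 1 - t ≤ hammingNorm c) ∧
      (∃ c ∈ C, c ≠ 0 ∧ hammingNorm c = N + 1 - t) ∧
      (∀ c ∈ dualCode C, c ≠ 0 → 2 ≤ hammingNorm c) ∧
      (∃ c ∈ dualCode C, c ≠ 0 ∧ hammingNorm c = 2) := by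
  rintro ⟨C, -, h_dim, h_dist, -, -, x, hx, -, hx_weight⟩
  obtain ⟨i, j, hij, h_supp⟩ := Finset.card_eq_two.mp hx_weight
  have h_ne (l : Fin (N + 1)) : x l ≠ 0 ↔ l = i ∨ l = j := by
    simpa using Finset.ext_iff.mp h_supp l
  let K : Submodule F (Fin (N + 1) → F) := C ⊓ LinearMap.ker (LinearMap.proj i)
  have hK_i : ∀ c ∈ K, c i = 0 := fun c hc => hc.2
  have hK_j : ∀ c ∈ K, c j = 0 := by
    intro c hc
    have h := hx c hc.1
    rw [Finset.sum_eq_single j, mul_eq_zero] at h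
    · exact h.resolve_left ((h_ne j).mpr (.inr rfl))
    · intro l _ hlj
      by_cases hl : x l = 0
      · rw [hl, zero_mul]
      · rw [((h_ne l).mp hl).resolve_right hlj, hK_i c hc, mul_zero]
    · simp
  have h_bound := plotkin_bound K (N + 1 - t) (fun c hc => h_dist c hc.1) {i, j}ᶜ (by
    intro c hc l hl
    simp only [Finset.mem_compl, Finset.mem_insert, Finset.mem_singleton, not_not] at hl
    rcases hl with rfl | rfl
    exacts [hK_i c hc, hK_j c hc])
  rw [Finset.card_compl, Finset.card_pair hij, Fintype.card_fin, hF] at h_bound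
  have h_card : q ^ 2 ≤ Nat.card K := by
    have h : Module.finrank F C ≤ Module.finrank F K + 1 :=
      finrank_le_finrank_inf_ker_add_one C (LinearMap.proj i)
    rw [Module.natCard_eq_pow_finrank (K := F), Nat.card_eq_fintype_card, hF]
    exact Nat.pow_le_pow_right (by lia) (by lia)
  generalize Nat.card K = M at h_bound h_card
  obtain ⟨s, rfl⟩ : ∃ s, t = s + 2 := ⟨t - 2, by lia⟩
  obtain ⟨r, rfl⟩ := Nat.exists_eq_add_of_le h_card
  have h_length : N + 1 - 2 = q * (s + 1) + s := by
    rw [hN, show s + 2 - 1 = s + 1 by lia, add_mul]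
    lia
  have h_weight : N + 1 - (s + 2) = q * (s + 1) := by
    rw [hN, show s + 2 - 1 = s + 1 by lia, add_mul]
    lia
  obtain ⟨p, rfl⟩ : ∃ p, q = p + 1 := ⟨q - 1, by lia⟩
  rw [h_length, h_weight, show (p + 1) ^ 2 + r - 1 = p ^ 2 + 2 * p + r by ring_nf; lia] at h_bound
  have hp : 0 < p := by lia
  nlinarith [mul_pos hp hp, mul_pos hp (mul_pos hp hp), Nat.zero_le (r * p), Nat.zero_le (r * s),
    h_bound]
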